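/- arXiv:0811.3186 — 3 statements merged into one kernel-verified Lean document; each statement's English description precedes it below -/
import Mathlib

section
/- Let n ≥ 2 and let A ∈ Mₙ(F) be a traceless matrix over F = ℂ((t)). Then there exists g ∈ SLₙ(F) such that the gauge transform B = Ga_g(A) = g A g⁻¹ − (∂_t g) g⁻¹ is in oper form: B_{j,i} = 0 for all j > i+1 and B_{i+1,i} ≠ 0 for all 1 ≤ i ≤ n−1. (This is the main theorem — every flat G-bundle on the punctured disc admits an oper structure — for the simply-connected semisimple group G = SLₙ; note that B is automatically traceless since tr((∂_t g) g⁻¹) = 0 for g ∈ SLₙ(F).) -/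
open HahnSeries Matrix

noncomputable section

/-- The formal derivative `∂ₜ` on the field `F = ℂ((t))` of formal Laurent series:
`∂ₜ (Σₙ aₙ tⁿ) = Σₙ n aₙ tⁿ⁻¹`. -/
def dt (f : LaurentSeries ℂ) : LaurentSeries ℂ where
  coeff := fun k => (k + 1 : ℤ) * f.coeff (k + 1)
  isPWO_support' := by
    apply Set.IsPWO.mono (f.isPWO_support'.image_of_monotone
      (f := fun k : ℤ => k - 1) (fun a b h => by simp only []; omega))
    intro k hk
    simp only [Function.mem_support, ne_eq] at hk
    refine ⟨k + 1, ?_, by ring⟩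
    simp only [Function.mem_support, ne_eq]
    intro h
    exact hk (by rw [h, mul_zero])

/-- A matrix `B ∈ Mₙ(F)` is in oper form if all entries strictly below the subdiagonal
vanish and all subdiagonal entries are nonzero. -/
def IsOperForm {n : ℕ} (B : Matrix (Fin n) (Fin n) (LaurentSeries ℂ)) : Prop :=
  (∀ i j : Fin n, (j : ℕ) + 1 < (i : ℕ) → B i j = 0) ∧
  (∀ i j : Fin n, (i : ℕ) = (j : ℕ) + 1 → B i j ≠ 0)

/-- The gauge action for `g ∈ SLₙ(F)`:  `Ga_g(A) = g A g⁻¹ - (∂ₜ g) g⁻¹`. -/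
def gaugeSL {n : ℕ} (g : Matrix.SpecialLinearGroup (Fin n) (LaurentSeries ℂ))
    (A : Matrix (Fin n) (Fin n) (LaurentSeries ℂ)) : Matrix (Fin n) (Fin n) (LaurentSeries ℂ) :=
  (g : Matrix (Fin n) (Fin n) (LaurentSeries ℂ)) * A *
      ((g⁻¹ : Matrix.SpecialLinearGroup (Fin n) (LaurentSeries ℂ)) :
        Matrix (Fin n) (Fin n) (LaurentSeries ℂ)) -
    ((g : Matrix (Fin n) (Fin n) (LaurentSeries ℂ)).map dt) *
      ((g⁻¹ : Matrix.SpecialLinearGroup (Fin n) (LaurentSeries ℂ)) :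
        Matrix (Fin n) (Fin n) (LaurentSeries ℂ))

/-- The operator `v ↦ D v + A v` on column vectors. -/
def connection {R : Type*} [CommRing R] {n : ℕ} (D : R → R) (A : Matrix (Fin n) (Fin n) R)
    (v : Fin n → R) : Fin n → R :=
  (fun k => D (v k)) + A *ᵥ v

lemma connection_smul {R : Type*} [CommRing R] [Differential R] {n : ℕ}
    (A : Matrix (Fin n) (Fin n) R) (s : R) (v : Fin n → R) :
    connection Differential.deriv A (s • v) =
      Differential.deriv s • v + s • connection Differential.deriv A v := by
  ext k
  simp only [connection, Matrix.mulVec_smul, Pi.add_apply, Pi.smul_apply, smul_eq_mul,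
    Derivation.leibniz]
  ring

open Polynomial in
lemma connection_eval {K : Type*} [Field K] [Differential K] {n : ℕ} {x : K}
    (hx : Differential.deriv x = 1) (A : Matrix (Fin n) (Fin n) K) (w : Fin n → K[X]) :
    (fun k => (connection (Differential.implicitDeriv 1) (A.map C) w k).eval x) =
      connection Differential.deriv A (fun k => (w k).eval x) := by
  ext k
  have h := Differential.deriv_aeval_eq_implicitDeriv x (1 : K[X]) (by simpa using hx) (w k)
  simp only [Polynomial.coe_aeval_eq_eval] at h
  simp [connection, Matrix.mulVec, dotProduct, eval_finsetSum, h]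

/-- The array determined by its zeroth column `e` and the recursion
`taylor i (j + 1) = taylor (i + 1) j - ∇ (taylor i j)`. -/
def connectionTaylor {R : Type*} [CommRing R] {n : ℕ} (D : R → R)
    (A : Matrix (Fin n) (Fin n) R) (e : ℕ → Fin n → R) (i : ℕ) : ℕ → Fin n → R
  | 0 => e i
  | j + 1 => connectionTaylor D A e (i + 1) j - connection D A (connectionTaylor D A e i j)

open Polynomial in
/-- There is a polynomial vector whose first iterated covariant derivatives take prescribed values
at `0`. -/
lemma exists_coeff_zero_iterate_connection {K : Type*} [Field K] [CharZero K] [Differential K]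
    {n : ℕ} (A : Matrix (Fin n) (Fin n) K) (e : ℕ → Fin n → K) (N : ℕ) :
    ∃ w : Fin n → K[X], ∀ i < N, ∀ k,
      ((connection (Differential.implicitDeriv 1) (A.map C))^[i] w k).coeff 0 = e i k := by
  set a := connectionTaylor Differential.deriv A e with ha
  set w : Fin n → K[X] := fun k =>
    ∑ j ∈ Finset.range N, C ((j.factorial : K)⁻¹ * a 0 j k) * X ^ j with hw
  suffices H : ∀ i j, i + j < N → ∀ k, (j.factorial : K) *
      ((connection (Differential.implicitDeriv 1) (A.map C))^[i] w k).coeff j = a i j k by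
    refine ⟨w, fun i hi k => ?_⟩
    simpa [ha, connectionTaylor] using H i 0 (by omega) k
  intro i
  induction i with
  | zero =>
    intro j hj k
    have hj' : j < N := by omega
    have : (j.factorial : K) ≠ 0 := by exact_mod_cast j.factorial_ne_zero
    simp only [hw, finsetSum_coeff, coeff_C_mul, coeff_X_pow, Function.iterate_zero, id_eq]
    simp [hj', this]
  | succ i ih =>
    intro j hj k
    rw [Function.iterate_succ_apply']
    set u := (connection (Differential.implicitDeriv 1) (A.map C))^[i] w with hu
    have h1 : (j.factorial : K) • (fun l => (u l).coeff j) = a i j := by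
      ext l
      exact ih j (by omega) l
    have h2 := ih (j + 1) (by omega) k
    have h3 : a i (j + 1) k = a (i + 1) j k - connection Differential.deriv A (a i j) k := rfl
    have h4 : Differential.deriv (j.factorial : K) = 0 := Derivation.map_natCast _ _
    rw [← h1, connection_smul, h4] at h3
    rw [sub_eq_iff_eq_add.mp h3.symm, ← h2, Nat.factorial_succ]
    simp [connection, Matrix.mulVec, dotProduct, finsetSum_coeff, Differential.implicitDeriv,
      coeff_derivative]
    ring

/-- A cyclic vector exists over a differential field of characteristic zero containing an element
of derivative one. -/
theorem exists_det_iterate_connection_ne_zero {K : Type*} [Field K] [CharZero K] [Differential K]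
    {t : K} (ht : Differential.deriv t = 1) {n : ℕ} (A : Matrix (Fin n) (Fin n) K) :
    ∃ v : Fin n → K,
      (Matrix.of fun k i : Fin n => (connection Differential.deriv A)^[i] v k).det ≠ 0 := by
  obtain ⟨w, hw⟩ := exists_coeff_zero_iterate_connection A
    (fun i k => if (k : ℕ) = i then 1 else 0) n
  set M : Matrix (Fin n) (Fin n) (Polynomial K) := Matrix.of fun k i : Fin n =>
    (connection (Differential.implicitDeriv 1) (A.map Polynomial.C))^[i] w k with hM
  have hM0 : M.det ≠ 0 := by
    intro h0
    have h1 : M.map Polynomial.constantCoeff = 1 := by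
      ext k i
      simpa [hM, Matrix.one_apply, Fin.ext_iff] using hw i i.2 k
    have h2 := RingHom.map_det Polynomial.constantCoeff M
    rw [RingHom.mapMatrix_apply, h1, h0] at h2
    simp at h2
  obtain ⟨m, hm⟩ : ∃ m : ℕ, M.det.eval (t - m) ≠ 0 := by
    by_contra! h
    refine hM0 (Polynomial.eq_zero_of_infinite_isRoot _ ?_)
    refine Set.Infinite.mono (s := Set.range fun m : ℕ => t - (m : K)) ?_
      (Set.infinite_range_of_injective fun a b hab => by simpa using hab)
    rintro _ ⟨m, rfl⟩
    exact h m
  have hx : Differential.deriv (t - (m : K)) = 1 := by simp [ht]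
  refine ⟨fun k => (w k).eval (t - m), ?_⟩
  have hiter (i : ℕ) : (connection Differential.deriv A)^[i] (fun k => (w k).eval (t - m)) =
      fun k => ((connection (Differential.implicitDeriv 1)
        (A.map Polynomial.C))^[i] w k).eval (t - m) := by
    induction i with
    | zero => rfl
    | succ i ih =>
      rw [Function.iterate_succ_apply', Function.iterate_succ_apply', ih, connection_eval hx]
  have h2 := RingHom.map_det (Polynomial.evalRingHom (t - (m : K))) M
  rw [Polynomial.coe_evalRingHom] at h2
  rw [h2] at hm
  convert hm using 2
  ext k i
  simp [hiter, hM]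

/-- There is a frame of determinant one in which the connection sends each vector but the last to a
combination of itself and the next one, the next one occurring with a nonzero coefficient. -/
theorem exists_det_eq_one_connection_col {K : Type*} [Field K] [CharZero K] [Differential K]
    {t : K} (ht : Differential.deriv t = 1) {n : ℕ} (hn : n ≠ 0)
    (A : Matrix (Fin n) (Fin n) K) :
    ∃ P : Matrix (Fin n) (Fin n) K, P.det = 1 ∧ ∀ i j : Fin n, (i : ℕ) = j + 1 →
      ∃ α β : K, β ≠ 0 ∧ connection Differential.deriv A (P.col j) = α • P.col j + β • P.col i := by
  obtain ⟨v, hv⟩ := exists_det_iterate_connection_ne_zero ht A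
  set M := Matrix.of fun k i : Fin n => (connection Differential.deriv A)^[i] v k with hM
  set s : Fin n → K := Function.update 1 ⟨n - 1, by omega⟩ M.det⁻¹ with hs
  have hs0 (i : Fin n) : s i ≠ 0 := by
    rw [hs, Function.update_apply]
    split_ifs
    · exact inv_ne_zero hv
    · simp
  have hcol (j : Fin n) : (Matrix.of fun k i => s i * M k i).col j =
      s j • (connection Differential.deriv A)^[j] v := rfl
  refine ⟨Matrix.of fun k i => s i * M k i, ?_, fun i j hij =>
    ⟨Differential.deriv (s j) / s j, s j / s i, div_ne_zero (hs0 j) (hs0 i), ?_⟩⟩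
  · rw [Matrix.det_mul_row, hs, Finset.prod_update_of_mem (Finset.mem_univ _)]
    simp [hv]
  · rw [hcol, hcol, connection_smul, hij, Function.iterate_succ_apply', smul_smul, smul_smul,
      div_mul_cancel₀ _ (hs0 j), div_mul_cancel₀ _ (hs0 i)]

lemma coeff_dt (f : LaurentSeries ℂ) (k : ℤ) :
    (dt f).coeff k = ((k + 1 : ℤ) : ℂ) * f.coeff (k + 1) := by
  simp [dt]

/-- The Leibniz rule for the Euler operator `t ∂ₜ`, which multiplies the `k`-th coefficient by `k`. -/
lemma coeff_euler_mul (f g : LaurentSeries ℂ) (k : ℤ) :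
    (k : ℂ) * (f * g).coeff k = (single 1 1 * dt f * g + f * (single 1 1 * dt g)).coeff k := by
  have h (f : LaurentSeries ℂ) (k : ℤ) : (single 1 1 * dt f).coeff k = (k : ℂ) * f.coeff k := by
    rw [coeff_single_mul, coeff_dt]
    simp
  have hsupp (f : LaurentSeries ℂ) : (single 1 1 * dt f).support ⊆ f.support := by
    intro i hi
    rw [mem_support, h] at hi
    exact right_ne_zero_of_mul hi
  rw [coeff_add, coeff_mul_left' f.isPWO_support (hsupp f),
    coeff_mul_right' g.isPWO_support (hsupp g), coeff_mul, Finset.mul_sum, ← Finset.sum_add_distrib]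
  refine Finset.sum_congr rfl fun ij hij => ?_
  have hk : ij.1 + ij.2 = k := by
    simpa using (Finset.mem_antidiagonal.mp hij).2.2
  rw [h, h, ← hk]
  push_cast
  ring

lemma dt_mul (f g : LaurentSeries ℂ) : dt (f * g) = f * dt g + g * dt f := by
  have h : single 1 1 * dt (f * g) = single 1 1 * (f * dt g + g * dt f) := by
    rw [show single 1 1 * (f * dt g + g * dt f) =
      single 1 1 * dt f * g + f * (single 1 1 * dt g) by ring]
    ext k
    rw [← coeff_euler_mul, coeff_single_mul, coeff_dt]
    simp
  exact mul_left_cancel₀ (by simp) h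

/-- An additive map satisfying the Leibniz rule makes a ring into a differential ring. -/
abbrev Differential.ofLeibniz {R : Type*} [CommRing R] (d : R →+ R)
    (h : ∀ f g, d (f * g) = f * d g + g * d f) : Differential R where
  deriv := Derivation.mk' d.toIntLinearMap h

instance : Differential (LaurentSeries ℂ) :=
  Differential.ofLeibniz
    { toFun := dt
      map_zero' := by ext k; simp [coeff_dt]
      map_add' := fun f g => by ext k; simp [coeff_dt, mul_add] }
    dt_mul

instance : CharZero (LaurentSeries ℂ) :=
  charZero_of_injective_ringHom (HahnSeries.C_injective (Γ := ℤ) (R := ℂ))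

lemma differential_deriv_eq_dt (f : LaurentSeries ℂ) : Differential.deriv f = dt f := rfl

lemma dt_single_one : dt (single 1 1) = 1 := by
  ext k
  rw [coeff_dt, ← single_zero_one, coeff_single, coeff_single]
  by_cases hk : k = 0 <;> simp [hk]

/-- The gauge transform is the matrix of the connection in the frame `g⁻¹`. -/
lemma gaugeSL_inv_apply {n : ℕ} (P : Matrix.SpecialLinearGroup (Fin n) (LaurentSeries ℂ))
    (A : Matrix (Fin n) (Fin n) (LaurentSeries ℂ)) (i j : Fin n) :
    gaugeSL P⁻¹ A i j =
      ((P⁻¹ : Matrix.SpecialLinearGroup _ _).1 *ᵥ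
        connection Differential.deriv A (P.1.col j)) i := by
  have hPg : (P⁻¹).1 * P.1 = 1 := by
    rw [← Matrix.SpecialLinearGroup.coe_mul, inv_mul_cancel, Matrix.SpecialLinearGroup.coe_one]
  have hd : (P⁻¹).1.map dt * P.1 = -((P⁻¹).1 * P.1.map dt) := by
    rw [eq_neg_iff_add_eq_zero]
    ext k l
    have := congrArg (fun M => Differential.deriv (M k l)) hPg
    have h1 : Differential.deriv ((1 : Matrix (Fin n) (Fin n) (LaurentSeries ℂ)) k l) = 0 := by
      rw [Matrix.one_apply]
      split_ifs <;> simp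
    simp only [h1, Matrix.mul_apply, map_sum, Derivation.leibniz, smul_eq_mul,
      Finset.sum_add_distrib, differential_deriv_eq_dt] at this
    simp only [Matrix.add_apply, Matrix.mul_apply, Matrix.map_apply, Matrix.zero_apply]
    rw [← this, add_comm]
    simp only [mul_comm]
  have hB : gaugeSL P⁻¹ A = (P⁻¹).1 * (P.1.map dt + A * P.1) := by
    rw [gaugeSL, inv_inv, hd, mul_add, sub_neg_eq_add, add_comm, mul_assoc]
  have hc : connection Differential.deriv A (P.1.col j) = (P.1.map dt + A * P.1).col j := by
    ext k
    simp [connection, differential_deriv_eq_dt, Matrix.mul_apply, Matrix.mulVec, dotProduct]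
  rw [hB, hc]
  rfl

/-- Any flat `SLₙ`-bundle on the punctured disc admits an oper structure: for every traceless
`A ∈ Mₙ(ℂ((t)))` there is `g ∈ SLₙ(ℂ((t)))` such that `Ga_g(A)` is in oper form. -/
theorem flat_bundle_has_oper_structure_SLn (n : ℕ) (hn : 2 ≤ n)
    (A : Matrix (Fin n) (Fin n) (LaurentSeries ℂ)) (hA : A.trace = 0) :
    ∃ g : Matrix.SpecialLinearGroup (Fin n) (LaurentSeries ℂ), IsOperForm (gaugeSL g A) := by
  obtain ⟨P, hP, hcol⟩ := exists_det_eq_one_connection_col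
    (t := (single 1 1 : LaurentSeries ℂ)) dt_single_one (by omega : n ≠ 0) A
  set Q : Matrix.SpecialLinearGroup (Fin n) (LaurentSeries ℂ) := ⟨P, hP⟩
  have hQ (i j : Fin n) :
      ((Q⁻¹).1 *ᵥ P.col j) i = (1 : Matrix (Fin n) (Fin n) (LaurentSeries ℂ)) i j := by
    rw [← Matrix.SpecialLinearGroup.coe_one, ← inv_mul_cancel Q]
    rfl
  have key (i j l : Fin n) (hl : (l : ℕ) = j + 1) : ∃ α β : LaurentSeries ℂ, β ≠ 0 ∧
      gaugeSL Q⁻¹ A i j = α * (1 : Matrix _ _ _) i j + β * (1 : Matrix _ _ _) i l := by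
    obtain ⟨α, β, hβ, h⟩ := hcol l j hl
    refine ⟨α, β, hβ, ?_⟩
    rw [gaugeSL_inv_apply, h, Matrix.mulVec_add, Matrix.mulVec_smul, Matrix.mulVec_smul]
    simp only [Pi.add_apply, Pi.smul_apply, smul_eq_mul, hQ]
  refine ⟨Q⁻¹, fun i j hij => ?_, fun i j hij => ?_⟩
  · obtain ⟨α, β, -, h⟩ := key i j ⟨j + 1, by omega⟩ rfl
    rw [h, Matrix.one_apply_ne (Fin.ne_of_val_ne (by omega)),
      Matrix.one_apply_ne (Fin.ne_of_val_ne (by simp; omega)), mul_zero, mul_zero, add_zero]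
  · obtain ⟨α, β, hβ, h⟩ := key i j i hij
    rw [h, Matrix.one_apply_ne (Fin.ne_of_val_ne (by omega)), Matrix.one_apply_eq]
    simpa using hβ
end
end

section
/- Let n ≥ 1, let r ≤ −2 be an integer, and let A ∈ tʳ Mₙ(O) ⊂ Mₙ(F) be such that its coefficient A_r of tʳ is a regular element of Mₙ(ℂ), i.e., the minimal polynomial of A_r has degree n. Then there exists g ∈ GLₙ(O) such that Ga_g(A) is in oper form: all entries strictly below the subdiagonal vanish and all subdiagonal entries are nonzero elements of F. (This is the extension of the reduction lemma from regular nilpotent to arbitrary regular leading term.) -/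
open HahnSeries Matrix

noncomputable section

/-- The gaugeGL action of `GLₙ(F)` on `Mₙ(F)`:  `Ga_g(A) = g A g⁻¹ - (∂ₜ g) g⁻¹`. -/
def gaugeGL {n : ℕ} (g : GL (Fin n) (LaurentSeries ℂ))
    (A : Matrix (Fin n) (Fin n) (LaurentSeries ℂ)) : Matrix (Fin n) (Fin n) (LaurentSeries ℂ) :=
  (g : Matrix (Fin n) (Fin n) (LaurentSeries ℂ)) * A *
      ((g⁻¹ : GL (Fin n) (LaurentSeries ℂ)) : Matrix (Fin n) (Fin n) (LaurentSeries ℂ)) -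
    ((g : Matrix (Fin n) (Fin n) (LaurentSeries ℂ)).map dt) *
      ((g⁻¹ : GL (Fin n) (LaurentSeries ℂ)) : Matrix (Fin n) (Fin n) (LaurentSeries ℂ))

/-- The minimal polynomial of a square matrix over a field equals that of its transpose. -/
theorem minpoly_transpose_matrix {K ι : Type*} [Field K] [Fintype ι] [DecidableEq ι]
    (M : Matrix ι ι K) : minpoly K Mᵀ = minpoly K M := by
  have key : ∀ (N : Matrix ι ι K) (p : Polynomial K),
      Polynomial.aeval Nᵀ p = (Polynomial.aeval N p)ᵀ := fun N p => by
    simp [Polynomial.aeval_eq_sum_range, Matrix.transpose_sum, Matrix.transpose_pow]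
  have hdvd : ∀ N : Matrix ι ι K, minpoly K Nᵀ ∣ minpoly K N := fun N =>
    minpoly.dvd K _ (by rw [key, minpoly.aeval, Matrix.transpose_zero])
  exact Polynomial.eq_of_monic_of_associated (minpoly.monic Mᵀ.isIntegral)
    (minpoly.monic M.isIntegral) (associated_of_dvd_dvd (hdvd M) (by simpa using hdvd Mᵀ))

/-- For a square matrix `M` over a field with minimal polynomial of degree `d`, there is a row vector
`w` such that `w, w M, …, w M ^ (d - 1)` are linearly independent. -/
theorem exists_linearIndependent_vecMul_pow {K ι : Type*} [Field K] [Fintype ι] [DecidableEq ι]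
    (M : Matrix ι ι K) :
    ∃ w : ι → K, LinearIndependent K
      (fun i : Fin (minpoly K M).natDegree => w ᵥ* M ^ (i : ℕ)) := by
  set f : Module.End K (ι → K) := Matrix.toLin' Mᵀ with hf
  have hpow : ∀ (k : ℕ) (w : ι → K), (f ^ k) w = w ᵥ* M ^ k := fun k w => by
    rw [hf, ← Matrix.toLin'_pow, Matrix.toLin'_apply, ← Matrix.transpose_pow,
      Matrix.mulVec_transpose]
  obtain ⟨x, hx⟩ := Module.exists_ker_toSpanSingleton_eq_annihilator (R := Polynomial K)
    (M := Module.AEval' f)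
  obtain ⟨w, rfl⟩ := (Module.AEval'.of f).surjective x
  rw [← Polynomial.span_minpoly_eq_annihilator, hf, Matrix.minpoly_toLin',
    minpoly_transpose_matrix] at hx
  refine ⟨w, Fintype.linearIndependent_iff.2 fun c hc => ?_⟩
  set p : Polynomial K := ∑ i : Fin (minpoly K M).natDegree, Polynomial.monomial (i : ℕ) (c i)
    with hp
  have hann : p ∈ LinearMap.ker (LinearMap.toSpanSingleton (Polynomial K) (Module.AEval' f)
      (Module.AEval'.of f w)) := by
    rw [LinearMap.mem_ker, LinearMap.toSpanSingleton_apply, hp, Finset.sum_smul]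
    simp_rw [← Polynomial.C_mul_X_pow_eq_monomial, mul_smul, Module.AEval'.X_pow_smul_of,
      Module.AEval.C_smul, ← map_smul, ← map_sum, Module.End.smul_def, hpow, hc, map_zero]
  rw [hx, Ideal.mem_span_singleton] at hann
  have hdeg : p.degree < (minpoly K M).degree := by
    rw [Polynomial.degree_eq_natDegree (minpoly.ne_zero M.isIntegral)]
    refine (Polynomial.degree_sum_le _ _).trans_lt
      ((Finset.sup_lt_iff (WithBot.bot_lt_coe _)).2 fun i _ => ?_)
    exact (Polynomial.degree_monomial_le _ _).trans_lt (by exact_mod_cast i.2)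
  have hp0 : p = 0 := Polynomial.eq_zero_of_dvd_of_degree_lt hann hdeg
  intro i
  have hi := congrArg (fun q => Polynomial.coeff q (i : ℕ)) hp0
  simpa [hp, Polynomial.finsetSum_coeff, Polynomial.coeff_monomial, Fin.val_inj] using hi

/-- The iterates of `v ↦ v M - Xᵐ ∂v` on row vectors of power series, starting from `w`. -/
def connectionIterate {R ι : Type*} [CommRing R] [Fintype ι] (m : ℕ)
    (M : Matrix ι ι (PowerSeries R)) (w : ι → PowerSeries R) : ℕ → ι → PowerSeries R
  | 0 => w
  | k + 1 => connectionIterate m M w k ᵥ* M -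
      fun j => PowerSeries.X ^ m * PowerSeries.derivative R (connectionIterate m M w k j)

theorem constantCoeff_connectionIterate {R ι : Type*} [CommRing R] [Fintype ι] [DecidableEq ι]
    {m : ℕ} (hm : m ≠ 0) (M : Matrix ι ι (PowerSeries R)) (w : ι → PowerSeries R) (k : ℕ) :
    PowerSeries.constantCoeff ∘ connectionIterate m M w k =
      (PowerSeries.constantCoeff ∘ w) ᵥ* M.map PowerSeries.constantCoeff ^ k := by
  induction k with
  | zero => simp [connectionIterate]
  | succ k ih =>
    rw [pow_succ, ← Matrix.vecMul_vecMul, ← ih]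
    ext j
    simp [connectionIterate, Matrix.vecMul, dotProduct, hm]

/-- A square matrix of power series over a field whose rows have linearly independent constant
terms is invertible. -/
theorem isUnit_of_linearIndependent_constantCoeff {K ι : Type*} [Field K] [Fintype ι]
    [DecidableEq ι] (G : Matrix ι ι (PowerSeries K))
    (h : LinearIndependent K fun i => PowerSeries.constantCoeff ∘ G i) : IsUnit G := by
  have hu : IsUnit (G.map (PowerSeries.constantCoeff (R := K))) :=
    Matrix.linearIndependent_rows_iff_isUnit.1 h
  rw [Matrix.isUnit_iff_isUnit_det, PowerSeries.isUnit_iff_constantCoeff, RingHom.map_det]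
  exact (Matrix.isUnit_iff_isUnit_det _).1 hu

theorem dt_coe (f : PowerSeries ℂ) :
    dt (f : LaurentSeries ℂ) = (PowerSeries.derivative ℂ f : PowerSeries ℂ) := by
  ext k
  change ((k + 1 : ℤ) : ℂ) * (f : LaurentSeries ℂ).coeff (k + 1) = _
  rw [PowerSeries.coeff_coe, PowerSeries.coeff_coe]
  rcases lt_trichotomy k (-1) with hk | rfl | hk
  · rw [if_pos (by omega), if_pos (by omega), mul_zero]
  · simp
  · lift k to ℕ using by omega
    rw [if_neg (by omega), if_neg (by omega), PowerSeries.coeff_derivative]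
    simp [mul_comm, Int.natAbs_natCast, show ((k : ℤ) + 1).natAbs = k + 1 by omega]

/-- If `∇ gᵢ = c gᵢ₋₁` for every row `gᵢ` of `g` other than the first one, where
`∇ v = v A - ∂ₜ v` and `c ≠ 0`, then `Ga_g(A)` is in oper form. -/
theorem isOperForm_gaugeGL {n : ℕ} (g : GL (Fin n) (LaurentSeries ℂ))
    (A : Matrix (Fin n) (Fin n) (LaurentSeries ℂ)) {c : LaurentSeries ℂ} (hc : c ≠ 0)
    (h : ∀ i k : Fin n, (i : ℕ) = k + 1 → (g.1 * A - g.1.map dt) i = c • g.1 k) :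
    IsOperForm (gaugeGL g A) := by
  have hrow : ∀ i k j : Fin n, (i : ℕ) = k + 1 →
      gaugeGL g A i j = c * (1 : Matrix (Fin n) (Fin n) (LaurentSeries ℂ)) k j := by
    intro i k j hik
    rw [gaugeGL, ← sub_mul, Matrix.mul_apply_eq_vecMul, h i k hik, Matrix.smul_vecMul,
      ← Matrix.mul_apply_eq_vecMul, Units.mul_inv, Pi.smul_apply, smul_eq_mul]
  refine ⟨fun i j hij => ?_, fun i j hij => ?_⟩
  · rw [hrow i ⟨i - 1, by omega⟩ j (by simp; omega), Matrix.one_apply_ne, mul_zero]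
    intro hj
    have := congrArg Fin.val hj
    simp at this
    omega
  · simpa [hrow i j j hij] using hc

/-- A Laurent series whose coefficients below degree `r` vanish is `t^r` times a power series. -/
theorem eq_single_mul_mk {R : Type*} [CommRing R] {r : ℤ} {f : LaurentSeries R}
    (hf : ∀ k < r, f.coeff k = 0) :
    f = HahnSeries.single r 1 * ofPowerSeries ℤ R (PowerSeries.mk fun k => f.coeff (r + k)) := by
  ext k
  obtain ⟨k, rfl⟩ : ∃ l, k = l + r := ⟨k - r, by ring⟩
  rw [HahnSeries.coeff_single_mul_add, one_mul, PowerSeries.coeff_coe]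
  split_ifs with hk
  · exact hf _ (by omega)
  · rw [PowerSeries.coeff_mk, Int.natCast_natAbs, abs_of_nonneg (by omega), add_comm]

/-- If `A ∈ tʳ Mₙ(O)` with `r ≤ -2` has regular leading coefficient `A_r` (minimal polynomial
of degree `n`), then there is `g ∈ GLₙ(O)` such that `Ga_g(A)` is in oper form. -/
theorem gauge_to_oper_of_regular_leading_term (n : ℕ) (hn : 1 ≤ n) (r : ℤ) (hr : r ≤ -2)
    (A : Matrix (Fin n) (Fin n) (LaurentSeries ℂ))
    (hAO : ∀ i j : Fin n, ∀ k : ℤ, k < r → (A i j).coeff k = 0)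
    (hreg : (minpoly ℂ
      (Matrix.of fun i j => (A i j).coeff r : Matrix (Fin n) (Fin n) ℂ)).natDegree = n) :
    ∃ g : GL (Fin n) (LaurentSeries ℂ),
      (∀ i j : Fin n, ∀ k : ℤ, k < 0 →
        ((g : Matrix (Fin n) (Fin n) (LaurentSeries ℂ)) i j).coeff k = 0) ∧
      (∀ i j : Fin n, ∀ k : ℤ, k < 0 →
        (((g⁻¹ : GL (Fin n) (LaurentSeries ℂ)) :
          Matrix (Fin n) (Fin n) (LaurentSeries ℂ)) i j).coeff k = 0) ∧
      IsOperForm (gaugeGL g A) := by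
  set M : Matrix (Fin n) (Fin n) (PowerSeries ℂ) :=
    Matrix.of fun i j => PowerSeries.mk fun k => (A i j).coeff (r + k) with hM
  set M₀ : Matrix (Fin n) (Fin n) ℂ := Matrix.of fun i j => (A i j).coeff r with hM₀
  have hMM₀ : M.map PowerSeries.constantCoeff = M₀ := by
    ext i j
    simp [hM, hM₀]
  have hAM : ∀ i j, A i j = single r 1 * (M i j : LaurentSeries ℂ) := fun i j =>
    eq_single_mul_mk (hAO i j)
  obtain ⟨w, hw⟩ := exists_linearIndependent_vecMul_pow M₀
  rw [hreg] at hw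
  obtain ⟨m, rfl⟩ : ∃ m : ℕ, r = -m := ⟨(-r).toNat, by omega⟩
  set P := connectionIterate m M fun j => PowerSeries.C (w j) with hP
  have hG : IsUnit (Matrix.of fun i : Fin n => P i.rev) := by
    refine isUnit_of_linearIndependent_constantCoeff _ ?_
    convert hw.comp Fin.rev Fin.rev_injective using 2 with i
    change PowerSeries.constantCoeff ∘ P i.rev = w ᵥ* M₀ ^ (i.rev : ℕ)
    rw [hP, constantCoeff_connectionIterate (by omega), hMM₀]
    congr 1
  obtain ⟨G, hG⟩ := hG
  have hcoe : ∀ f : PowerSeries ℂ, ∀ k < 0, (f : LaurentSeries ℂ).coeff k = 0 := fun f k hk => by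
    rw [PowerSeries.coeff_coe, if_pos hk]
  refine ⟨Matrix.GeneralLinearGroup.map (ofPowerSeries ℤ ℂ) G,
    fun i j => hcoe (G.1 i j), fun i j => hcoe (G.2 i j),
    isOperForm_gaugeGL _ _ (c := single (-m : ℤ) 1) (single_ne_zero one_ne_zero) ?_⟩
  intro i k hik
  have hrev : (k.rev : ℕ) = i.rev + 1 := by simp only [Fin.val_rev]; omega
  have hGP : ∀ a b, G.1 a b = P a.rev b := fun a b => by rw [hG]; rfl
  ext1 j
  have hX : HahnSeries.single (-m : ℤ) (1 : ℂ) * (ofPowerSeries ℤ ℂ) (PowerSeries.X ^ m) = 1 := by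
    rw [ofPowerSeries_X_pow, single_mul_single]
    simp
  have hstep : P k.rev j = ∑ l, P i.rev l * M l j -
      PowerSeries.X ^ m * PowerSeries.derivative ℂ (P i.rev j) := by
    rw [hrev]
    rfl
  simp only [Matrix.sub_apply, Matrix.mul_apply, Matrix.map_apply, Pi.smul_apply, smul_eq_mul,
    Matrix.GeneralLinearGroup.map_apply, hGP, dt_coe, hAM, hstep, map_sub, map_sum, map_mul,
    mul_sub, ← mul_assoc, hX, one_mul, Finset.mul_sum]
  congr 1
  exact Finset.sum_congr rfl fun l _ => by ring
end
end

section
/- Let V be a finite-dimensional vector space over F = ℂ((t)) with a connection ∇. Then for any lattice L ⊂ V, the preimage ∇⁻¹(L) = {v ∈ V : ∇v ∈ L} is also a lattice in V. -/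
open HahnSeries Matrix

noncomputable section

/-- An `O`-lattice in an `F`-vector space `V` (`O = ℂ[[t]]`, `F = ℂ((t))`): a finitely
generated `O`-submodule which spans `V` over `F`. -/
def IsOLattice {V : Type} [AddCommGroup V] [Module (PowerSeries ℂ) V]
    [Module (LaurentSeries ℂ) V] (M : Submodule (PowerSeries ℂ) V) : Prop :=
  M.FG ∧ Submodule.span (LaurentSeries ℂ) (M : Set V) = ⊤

/-- Two `ℂ`-subspaces `L, L'` of `V` are commensurable if `L/(L ∩ L')` and `L'/(L ∩ L')`
are finite-dimensional over `ℂ`. -/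
def AreCommensurable {V : Type} [AddCommGroup V] [Module ℂ V]
    (L L' : Submodule ℂ V) : Prop :=
  FiniteDimensional ℂ (↥L ⧸ Submodule.comap L.subtype (L ⊓ L')) ∧
  FiniteDimensional ℂ (↥L' ⧸ Submodule.comap L'.subtype (L ⊓ L'))

/-- A lattice in `V`: a `ℂ`-subspace commensurable with some `O`-lattice. -/
def IsLatticeIn {V : Type} [AddCommGroup V] [Module ℂ V] [Module (PowerSeries ℂ) V]
    [Module (LaurentSeries ℂ) V] [IsScalarTower ℂ (PowerSeries ℂ) V]
    (L : Submodule ℂ V) : Prop :=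
  ∃ M : Submodule (PowerSeries ℂ) V, IsOLattice M ∧
    AreCommensurable L (M.restrictScalars ℂ)

/-- Laurent series whose coefficients in degrees below `N` vanish. -/
def orderGE (N : ℤ) : Submodule ℂ (LaurentSeries ℂ) where
  carrier := {f | ∀ k < N, f.coeff k = 0}
  zero_mem' := fun k _ => rfl
  add_mem' := fun hf hg k hk => by rw [coeff_add, hf k hk, hg k hk, add_zero]
  smul_mem' := fun c f hf k hk => by rw [coeff_smul, hf k hk, smul_zero]

namespace orderGE

theorem mono {N N' : ℤ} (h : N' ≤ N) : orderGE N ≤ orderGE N' :=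
  fun _ hf k hk => hf k (hk.trans_le h)

theorem order_le_mem (f : LaurentSeries ℂ) : f ∈ orderGE f.order :=
  fun _ hk => coeff_eq_zero_of_lt_order hk

theorem mul_mem {a f : LaurentSeries ℂ} {d m : ℤ} (ha : a ∈ orderGE d) (hf : f ∈ orderGE m) :
    a * f ∈ orderGE (d + m) := by
  intro k hk
  rw [coeff_mul]
  refine Finset.sum_eq_zero fun ij hij => ?_
  obtain ⟨-, -, h⟩ := Finset.mem_antidiagonal.1 hij
  rcases lt_or_ge ij.1 d with h1 | h1
  · rw [ha _ h1, zero_mul]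
  · rw [hf ij.2 (by omega), mul_zero]

theorem coeff_mul_add {a f : LaurentSeries ℂ} {d m : ℤ} (ha : a ∈ orderGE d)
    (hf : f ∈ orderGE m) : (a * f).coeff (d + m) = a.coeff d * f.coeff m := by
  rw [coeff_mul]
  refine Finset.sum_eq_single (d, m) (fun ij hij hne => ?_) fun h => ?_
  · obtain ⟨-, -, h⟩ := Finset.mem_antidiagonal.1 hij
    rcases lt_or_ge ij.1 d with h1 | h1
    · rw [ha _ h1, zero_mul]
    · rcases lt_or_ge ij.2 m with h2 | h2
      · rw [hf _ h2, mul_zero]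
      · exact absurd (Prod.ext (by dsimp only; omega) (by dsimp only; omega)) hne
  · simp only [Finset.mem_antidiagonal, mem_support, and_true, not_and_or, not_not] at h
    rcases h with h | h <;> simp [h]

theorem ofPowerSeries_mem (p : PowerSeries ℂ) : ofPowerSeries ℤ ℂ p ∈ orderGE 0 := by
  intro k hk
  rw [PowerSeries.coeff_coe, if_pos hk]

theorem single_mem (N : ℤ) (c : ℂ) : single N c ∈ orderGE N :=
  fun _ hk => coeff_single_of_ne hk.ne

theorem powerSeries_smul_mem {p : PowerSeries ℂ} {f : LaurentSeries ℂ} {N : ℤ}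
    (hf : f ∈ orderGE N) : p • f ∈ orderGE N := by
  rw [Algebra.smul_def, LaurentSeries.coe_algebraMap]
  simpa using mul_mem (ofPowerSeries_mem p) hf

theorem exists_eq_smul_single {f : LaurentSeries ℂ} {N : ℤ} (hf : f ∈ orderGE N) :
    ∃ p : PowerSeries ℂ, f = p • (single N 1 : LaurentSeries ℂ) := by
  refine ⟨PowerSeries.mk fun n => f.coeff (N + n), ?_⟩
  rw [Algebra.smul_def, LaurentSeries.coe_algebraMap, mul_comm]
  ext k
  rw [coeff_single_mul, one_mul, PowerSeries.coeff_coe]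
  split_ifs with h
  · exact hf k (by omega)
  · rw [PowerSeries.coeff_mk]
    congr 1
    omega

theorem exists_truncation {f : LaurentSeries ℂ} {N : ℤ} (hf : f ∈ orderGE N) :
    ∃ g ∈ orderGE 0,
      f = g + ∑ i ∈ Finset.Ico N 0, f.coeff i • (single i 1 : LaurentSeries ℂ) := by
  refine ⟨f - ∑ i ∈ Finset.Ico N 0, f.coeff i • (single i 1 : LaurentSeries ℂ), ?_, by ring⟩
  intro k hk
  rw [coeff_sub, coeff_sum]
  rcases lt_or_ge k N with h | h
  · rw [hf k h, Finset.sum_eq_zero, sub_zero]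
    intro i hi
    rw [Finset.mem_Ico] at hi
    rw [coeff_smul, coeff_single_of_ne (by omega), smul_zero]
  · rw [Finset.sum_eq_single k]
    · simp
    · intro i _ hi
      rw [coeff_smul, coeff_single_of_ne (Ne.symm hi), smul_zero]
    · intro hk'
      exact absurd (Finset.mem_Ico.2 ⟨h, hk⟩) hk'

theorem dt_mem {f : LaurentSeries ℂ} {N : ℤ} (hf : f ∈ orderGE N) :
    dt f ∈ orderGE (N - 1) := by
  intro k hk
  change ((k + 1 : ℤ) : ℂ) * f.coeff (k + 1) = 0
  rw [hf _ (by omega), mul_zero]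

end orderGE

theorem dt_add (f g : LaurentSeries ℂ) : dt (f + g) = dt f + dt g := by
  ext k
  exact mul_add _ _ _

/-- The Euler operator `t ∂ₜ` on formal Laurent series. -/
def euler (f : LaurentSeries ℂ) : LaurentSeries ℂ := single 1 1 * dt f

theorem coeff_euler (f : LaurentSeries ℂ) (k : ℤ) : (euler f).coeff k = k * f.coeff k := by
  rw [euler, coeff_single_mul, one_mul]
  change ((k - 1 + 1 : ℤ) : ℂ) * f.coeff (k - 1 + 1) = _
  rw [sub_add_cancel]

theorem euler_sub (f g : LaurentSeries ℂ) : euler (f - g) = euler f - euler g := by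
  ext k
  simp only [coeff_euler, coeff_sub, mul_sub]

theorem coeff_euler_iterate (f : LaurentSeries ℂ) (i : ℕ) (k : ℤ) :
    (euler^[i] f).coeff k = (k : ℂ) ^ i * f.coeff k := by
  induction i with
  | zero => simp
  | succ i ih => rw [Function.iterate_succ_apply', coeff_euler, ih, pow_succ', mul_assoc]

theorem orderGE.euler_iterate_mem {f : LaurentSeries ℂ} {N : ℤ} (hf : f ∈ orderGE N) (i : ℕ) :
    euler^[i] f ∈ orderGE N := by
  intro k hk
  rw [coeff_euler_iterate, hf k hk, mul_zero]

/-- A nonzero linear differential operator on `ℂ((t))` has bounded preimages of bounded sets. -/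
theorem exists_orderGE_of_eulerOperator_mem (s : Finset ℕ) (a : ℕ → LaurentSeries ℂ)
    (ha : ∃ i ∈ s, a i ≠ 0) (N : ℤ) :
    ∃ K : ℤ, ∀ f, ∑ i ∈ s, a i * euler^[i] f ∈ orderGE N → f ∈ orderGE K := by
  classical
  obtain ⟨d, hd, j, hj, hjd⟩ : ∃ d : ℤ, (∀ i ∈ s, a i ∈ orderGE d) ∧
      ∃ j ∈ s, (a j).coeff d ≠ 0 := by
    obtain ⟨i, his, hi⟩ := ha
    obtain ⟨j, hj, hmin⟩ := (s.filter fun i => a i ≠ 0).exists_min_image (fun i => (a i).order)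
      ⟨i, Finset.mem_filter.2 ⟨his, hi⟩⟩
    rw [Finset.mem_filter] at hj
    refine ⟨(a j).order, fun l hl => ?_, j, hj.1, mt coeff_order_eq_zero.1 hj.2⟩
    by_cases h : a l = 0
    · rw [h]
      exact zero_mem _
    · exact orderGE.mono (hmin l (Finset.mem_filter.2 ⟨hl, h⟩)) (orderGE.order_le_mem _)
  let p : Polynomial ℂ := ∑ i ∈ s, Polynomial.monomial i ((a i).coeff d)
  have hp : p ≠ 0 := by
    intro h
    have := congrArg (fun q : Polynomial ℂ => q.coeff j) h
    simp [p, Polynomial.finsetSum_coeff, Polynomial.coeff_monomial, hj, hjd] at this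
  have hfin : {m : ℤ | p.eval (m : ℂ) = 0}.Finite := by
    refine ((Polynomial.finite_setOfPred_isRoot hp).preimage
      (Int.cast_injective (α := ℂ)).injOn).subset fun m hm => hm
  obtain ⟨K, hK⟩ := hfin.bddBelow
  refine ⟨min K (N - d), fun f hf => ?_⟩
  by_cases hf0 : f = 0
  · rw [hf0]
    exact zero_mem _
  refine orderGE.mono ?_ (orderGE.order_le_mem f)
  by_contra! hlt
  obtain ⟨h1, h2⟩ := lt_min_iff.1 hlt
  have hcoeff := hf (d + f.order) (by omega)
  rw [coeff_sum] at hcoeff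
  have hterm : ∀ i ∈ s, (a i * euler^[i] f).coeff (d + f.order) =
      (a i).coeff d * (f.order : ℂ) ^ i * f.coeff f.order := fun i hi => by
    rw [orderGE.coeff_mul_add (hd i hi) (orderGE.euler_iterate_mem (orderGE.order_le_mem f) i),
      coeff_euler_iterate, mul_assoc]
  rw [Finset.sum_congr rfl hterm, ← Finset.sum_mul, mul_eq_zero] at hcoeff
  rcases hcoeff with h | h
  · refine absurd (hK (?_ : p.eval (f.order : ℂ) = 0)) (not_le.2 h1)
    simpa [p, Polynomial.eval_finsetSum, Polynomial.eval_monomial] using h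
  · exact hf0 (coeff_order_eq_zero.1 h)

section AlmostLE

variable {V : Type} [AddCommGroup V] [Module ℂ V]

/-- `A` is contained in `B` up to a finite-dimensional space. -/
def AlmostLE (A B : Submodule ℂ V) : Prop := ∃ S : Submodule ℂ V, S.FG ∧ A ≤ B ⊔ S

theorem AlmostLE.of_le {A B : Submodule ℂ V} (h : A ≤ B) : AlmostLE A B :=
  ⟨⊥, Submodule.fg_bot, h.trans le_sup_left⟩

theorem AlmostLE.trans {A B C : Submodule ℂ V} (h : AlmostLE A B) (h' : AlmostLE B C) :
    AlmostLE A C := by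
  obtain ⟨S, hS, hA⟩ := h
  obtain ⟨T, hT, hB⟩ := h'
  exact ⟨T ⊔ S, hT.sup hS, hA.trans (by rw [← sup_assoc]; exact sup_le_sup_right hB S)⟩

theorem almostLE_iff_fg_map_mkQ {A B : Submodule ℂ V} :
    AlmostLE A B ↔ (A.map B.mkQ).FG := by
  constructor
  · rintro ⟨S, hS, h⟩
    have hle : A.map B.mkQ ≤ S.map B.mkQ := by
      refine (Submodule.map_mono h).trans ?_
      rw [Submodule.map_sup, Submodule.mkQ_map_self, bot_sup_eq]
    have : Module.Finite ℂ (S.map B.mkQ) := Module.Finite.iff_fg.2 (hS.map _)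
    exact Module.Finite.iff_fg.1 (Submodule.finiteDimensional_of_le hle)
  · rintro ⟨s, hs⟩
    have hsub : (s : Set (V ⧸ B)) ⊆ B.mkQ '' A := by
      rw [← Submodule.map_coe, ← hs]
      exact Submodule.subset_span
    classical
    obtain ⟨u, -, hu⟩ := Finset.subset_set_image_iff.1 hsub
    refine ⟨Submodule.span ℂ u, ⟨u, rfl⟩, ?_⟩
    have h : A.map B.mkQ ≤ (Submodule.span ℂ (u : Set V)).map B.mkQ := by
      rw [← hs, ← hu, Submodule.map_span, Finset.coe_image]
    rw [Submodule.map_le_iff_le_comap, Submodule.comap_map_mkQ] at h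
    exact h

theorem AlmostLE.comap {A B : Submodule ℂ V} (h : AlmostLE A B) (f : V →ₗ[ℂ] V) :
    AlmostLE (A.comap f) (B.comap f) := by
  rw [almostLE_iff_fg_map_mkQ] at h ⊢
  have hinj : LinearMap.ker ((B.comap f).mapQ B f le_rfl) = ⊥ := by
    rw [Submodule.mapQ, Submodule.ker_liftQ_eq_bot]
    rw [LinearMap.ker_comp, Submodule.ker_mkQ]
  refine Submodule.fg_of_fg_map_injective _ (LinearMap.ker_eq_bot.1 hinj) ?_
  rw [← Submodule.map_comp, Submodule.mapQ_mkQ, Submodule.map_comp]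
  have : Module.Finite ℂ (A.map B.mkQ) := Module.Finite.iff_fg.2 h
  exact Module.Finite.iff_fg.1
    (Submodule.finiteDimensional_of_le (Submodule.map_mono (Submodule.map_comap_le f A)))

theorem finiteDimensional_quotient_inf_iff {A B : Submodule ℂ V} :
    FiniteDimensional ℂ (A ⧸ Submodule.comap A.subtype (A ⊓ B)) ↔ AlmostLE A B := by
  have hker : Submodule.comap A.subtype (A ⊓ B) = LinearMap.ker (B.mkQ.comp A.subtype) := by
    rw [LinearMap.ker_comp, Submodule.ker_mkQ]
    ext x
    simp
  have hrange : LinearMap.range (B.mkQ.comp A.subtype) = A.map B.mkQ := by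
    rw [LinearMap.range_comp, Submodule.range_subtype]
  rw [almostLE_iff_fg_map_mkQ, ← Module.Finite.iff_fg, hker, ← hrange]
  exact Module.Finite.equiv_iff (LinearMap.quotKerEquivRange _)

theorem areCommensurable_iff {A B : Submodule ℂ V} :
    AreCommensurable A B ↔ AlmostLE A B ∧ AlmostLE B A := by
  refine and_congr finiteDimensional_quotient_inf_iff ?_
  rw [← finiteDimensional_quotient_inf_iff]
  exact Module.Finite.equiv_iff (Submodule.quotEquivOfEq _ _ (by rw [inf_comm]))

end AlmostLE

theorem exists_nontrivial_relation (K : Type*) {W : Type*} [Field K] [AddCommGroup W] [Module K W]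
    [FiniteDimensional K W] (u : ℕ → W) :
    ∃ (s : Finset ℕ) (a : ℕ → K), ∑ i ∈ s, a i • u i = 0 ∧ ∃ i ∈ s, a i ≠ 0 :=
  not_linearIndependent_iff.1 fun h =>
    not_finite_iff_infinite.2 (inferInstanceAs (Infinite ℕ)) h.finite

section Bounded

variable {V : Type} [AddCommGroup V] [Module (LaurentSeries ℂ) V] {ι : Type} [Fintype ι]
  (b : Module.Basis ι (LaurentSeries ℂ) V)

theorem exists_functional_mem_orderGE_of_repr {X : Set V} {K : ℤ}
    (hX : ∀ x ∈ X, ∀ l, b.repr x l ∈ orderGE K)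
    (ψ : V →ₗ[LaurentSeries ℂ] LaurentSeries ℂ) :
    ∃ N : ℤ, ∀ x ∈ X, ψ x ∈ orderGE N := by
  obtain ⟨N, hN⟩ := (Finset.univ.image fun l => K + (ψ (b l)).order).bddBelow
  refine ⟨N, fun x hx => ?_⟩
  rw [← b.sum_repr x, map_sum]
  refine sum_mem fun l _ => ?_
  rw [map_smul, smul_eq_mul]
  exact orderGE.mono (hN (Finset.mem_coe.2 (Finset.mem_image_of_mem _ (Finset.mem_univ l))))
    (orderGE.mul_mem (hX x hx l) (orderGE.order_le_mem _))

theorem exists_repr_mem_orderGE {X : Set V}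
    (hX : ∀ ψ : V →ₗ[LaurentSeries ℂ] LaurentSeries ℂ, ∃ N : ℤ, ∀ x ∈ X, ψ x ∈ orderGE N) :
    ∃ K : ℤ, ∀ x ∈ X, ∀ l, b.repr x l ∈ orderGE K := by
  choose N hN using fun l => hX (b.coord l)
  obtain ⟨K, hK⟩ := (Finset.univ.image N).bddBelow
  exact ⟨K, fun x hx l => orderGE.mono
    (hK (Finset.mem_coe.2 (Finset.mem_image_of_mem _ (Finset.mem_univ l)))) (hN l x hx)⟩

variable [Module (PowerSeries ℂ) V] [IsScalarTower (PowerSeries ℂ) (LaurentSeries ℂ) V]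

theorem exists_functional_mem_orderGE_of_fg {M : Submodule (PowerSeries ℂ) V} (hM : M.FG)
    (ψ : V →ₗ[LaurentSeries ℂ] LaurentSeries ℂ) :
    ∃ N : ℤ, ∀ x ∈ M, ψ x ∈ orderGE N := by
  classical
  obtain ⟨s, rfl⟩ := hM
  obtain ⟨N, hN⟩ := (s.image fun x => (ψ x).order).bddBelow
  refine ⟨N, fun x hx => ?_⟩
  induction hx using Submodule.span_induction with
  | mem x hx =>
    exact orderGE.mono (hN (Finset.mem_coe.2 (Finset.mem_image_of_mem _ hx)))
      (orderGE.order_le_mem _)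
  | zero => simp
  | add x y _ _ hx hy => simpa using add_mem hx hy
  | smul p x _ hx =>
    rw [← algebraMap_smul (LaurentSeries ℂ) p x, map_smul, smul_eq_mul, ← Algebra.smul_def]
    exact orderGE.powerSeries_smul_mem hx

theorem exists_isOLattice_of_repr (K : ℤ) :
    ∃ M : Submodule (PowerSeries ℂ) V, IsOLattice M ∧
      ∀ x, (∀ l, b.repr x l ∈ orderGE K) → x ∈ M := by
  refine ⟨Submodule.span (PowerSeries ℂ)
      (Set.range fun l => (single K 1 : LaurentSeries ℂ) • b l),
    ⟨Submodule.fg_span (Set.finite_range _), ?_⟩, fun x hx => ?_⟩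
  · rw [← top_le_iff, ← b.span_eq, Submodule.span_le]
    rintro _ ⟨l, rfl⟩
    have h : b l = (single (-K) 1 : LaurentSeries ℂ) • (single K 1 : LaurentSeries ℂ) • b l := by
      rw [smul_smul, single_mul_single]
      simp
    rw [h]
    exact Submodule.smul_mem _ _ (Submodule.subset_span (Submodule.subset_span ⟨l, rfl⟩))
  · rw [← b.sum_repr x]
    refine sum_mem fun l _ => ?_
    obtain ⟨p, hp⟩ := orderGE.exists_eq_smul_single (hx l)
    rw [hp, smul_assoc]
    exact Submodule.smul_mem _ _ (Submodule.subset_span ⟨l, rfl⟩)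

end Bounded

section Connection

variable {V : Type} [AddCommGroup V] [Module ℂ V] [Module (LaurentSeries ℂ) V]

/-- The action of `t ∇` on the dual space: `(t ∇ φ)(x) = t ∂ₜ (φ x) - φ (t ∇ x)`. -/
def dualEuler (nabla : V →ₗ[ℂ] V)
    (hleib : ∀ (f : LaurentSeries ℂ) (v : V), nabla (f • v) = dt f • v + f • nabla v)
    (φ : V →ₗ[LaurentSeries ℂ] LaurentSeries ℂ) : V →ₗ[LaurentSeries ℂ] LaurentSeries ℂ where
  toFun x := euler (φ x) - single 1 1 * φ (nabla x)
  map_add' x y := by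
    simp only [map_add, euler, dt_add]
    ring
  map_smul' c x := by
    have hdt : dt (c * φ x) = dt c * φ x + c * dt (φ x) := by
      rcases eq_or_ne x 0 with rfl | hx
      · have h0 : dt 0 = 0 := by simpa using dt_add 0 0
        simp [h0]
      · refine smul_left_injective _ hx ?_
        have h := hleib (c * φ x) x
        rw [mul_smul, hleib, hleib, smul_add, ← add_assoc, mul_smul] at h
        simpa only [add_smul, mul_smul] using (add_right_cancel h).symm
    simp only [hleib, map_add, map_smul, smul_eq_mul, euler, hdt, RingHom.id_apply]
    ring

/-- A set on whose image under `∇` all functionals are bounded has bounded functionals. -/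
theorem exists_functional_mem_orderGE [FiniteDimensional (LaurentSeries ℂ) V]
    (nabla : V →ₗ[ℂ] V)
    (hleib : ∀ (f : LaurentSeries ℂ) (v : V), nabla (f • v) = dt f • v + f • nabla v)
    (X : Set V)
    (hX : ∀ ψ : V →ₗ[LaurentSeries ℂ] LaurentSeries ℂ,
      ∃ N : ℤ, ∀ x ∈ X, ψ (nabla x) ∈ orderGE N)
    (φ : V →ₗ[LaurentSeries ℂ] LaurentSeries ℂ) :
    ∃ K : ℤ, ∀ x ∈ X, φ x ∈ orderGE K := by
  have happrox : ∀ i : ℕ, ∃ N : ℤ, ∀ x ∈ X,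
      euler^[i] (φ x) - (dualEuler nabla hleib)^[i] φ x ∈ orderGE N := by
    intro i
    induction i with
    | zero => exact ⟨0, fun x _ => by simp⟩
    | succ i ih =>
      obtain ⟨N, hN⟩ := ih
      obtain ⟨N', hN'⟩ := hX ((dualEuler nabla hleib)^[i] φ)
      refine ⟨min N (1 + N'), fun x hx => ?_⟩
      have h : euler^[i + 1] (φ x) - (dualEuler nabla hleib)^[i + 1] φ x =
          euler (euler^[i] (φ x) - (dualEuler nabla hleib)^[i] φ x) +
            single 1 1 * (dualEuler nabla hleib)^[i] φ (nabla x) := by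
        rw [Function.iterate_succ_apply', Function.iterate_succ_apply', euler_sub]
        simp only [dualEuler, LinearMap.coe_mk, AddHom.coe_mk]
        ring
      rw [h]
      exact add_mem
        (orderGE.mono (min_le_left _ _) (orderGE.euler_iterate_mem (hN x hx) 1))
        (orderGE.mono (min_le_right _ _)
          (orderGE.mul_mem (orderGE.single_mem 1 1) (hN' x hx)))
  obtain ⟨s, a, hrel, ha⟩ := exists_nontrivial_relation (LaurentSeries ℂ)
    fun i => (dualEuler nabla hleib)^[i] φ
  choose N hN using happrox
  obtain ⟨N₀, hN₀⟩ := (s.image fun i => (a i).order + N i).bddBelow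
  obtain ⟨K, hK⟩ := exists_orderGE_of_eulerOperator_mem s a ha N₀
  refine ⟨K, fun x hx => hK _ ?_⟩
  have h0 : ∑ i ∈ s, a i * (dualEuler nabla hleib)^[i] φ x = 0 := by
    have := LinearMap.congr_fun hrel x
    simpa [LinearMap.sum_apply] using this
  rw [← sub_zero (∑ i ∈ s, _), ← h0, ← Finset.sum_sub_distrib]
  refine sum_mem fun i hi => ?_
  rw [← mul_sub]
  exact orderGE.mono (hN₀ (Finset.mem_coe.2 (Finset.mem_image_of_mem _ hi)))
    (orderGE.mul_mem (orderGE.order_le_mem _) (hN i x hx))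

/-- A connection maps bounded sets to bounded sets. -/
theorem exists_functional_nabla_mem_orderGE (nabla : V →ₗ[ℂ] V)
    (hleib : ∀ (f : LaurentSeries ℂ) (v : V), nabla (f • v) = dt f • v + f • nabla v)
    {ι : Type} [Fintype ι]
    (b : Module.Basis ι (LaurentSeries ℂ) V) {X : Set V} {K : ℤ}
    (hX : ∀ x ∈ X, ∀ l, b.repr x l ∈ orderGE K)
    (ψ : V →ₗ[LaurentSeries ℂ] LaurentSeries ℂ) :
    ∃ N : ℤ, ∀ x ∈ X, ψ (nabla x) ∈ orderGE N := by
  obtain ⟨N, hN⟩ := (Finset.univ.image fun l => K - 1 + (ψ (b l)).order).bddBelow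
  obtain ⟨N', hN'⟩ := (Finset.univ.image fun l => K + (ψ (nabla (b l))).order).bddBelow
  refine ⟨min N N', fun x hx => ?_⟩
  rw [← b.sum_repr x, map_sum, map_sum]
  refine sum_mem fun l _ => ?_
  rw [hleib, map_add, map_smul, map_smul, smul_eq_mul, smul_eq_mul]
  refine add_mem (orderGE.mono ((min_le_left _ _).trans
      (hN (Finset.mem_coe.2 (Finset.mem_image_of_mem _ (Finset.mem_univ l)))))
    (orderGE.mul_mem (orderGE.dt_mem (hX x hx l)) (orderGE.order_le_mem _)))
    (orderGE.mono ((min_le_right _ _).trans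
      (hN' (Finset.mem_coe.2 (Finset.mem_image_of_mem _ (Finset.mem_univ l)))))
    (orderGE.mul_mem (hX x hx l) (orderGE.order_le_mem _)))

end Connection

/-- A bounded subspace is almost contained in any `O`-submodule containing a basis. -/
theorem almostLE_of_repr {V : Type} [AddCommGroup V] [Module ℂ V] [Module (PowerSeries ℂ) V]
    [Module (LaurentSeries ℂ) V] [IsScalarTower ℂ (PowerSeries ℂ) V]
    [IsScalarTower ℂ (LaurentSeries ℂ) V] [IsScalarTower (PowerSeries ℂ) (LaurentSeries ℂ) V]
    {ι : Type} [Fintype ι] (b : Module.Basis ι (LaurentSeries ℂ) V) {A : Submodule ℂ V} {K : ℤ}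
    (hA : ∀ x ∈ A, ∀ l, b.repr x l ∈ orderGE K) {M : Submodule (PowerSeries ℂ) V}
    (hM : ∀ l, b l ∈ M) : AlmostLE A (M.restrictScalars ℂ) := by
  refine ⟨Submodule.span ℂ ((fun q : ℤ × ι => (single q.1 1 : LaurentSeries ℂ) • b q.2) ''
      (Set.Ico K 0 ×ˢ Set.univ)),
    Submodule.fg_span (((Set.finite_Ico K 0).prod Set.finite_univ).image _), fun x hx => ?_⟩
  rw [← b.sum_repr x]
  refine sum_mem fun l _ => ?_
  obtain ⟨g, hg, h⟩ := orderGE.exists_truncation (hA x hx l)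
  rw [h, add_smul, Finset.sum_smul]
  refine Submodule.add_mem_sup ?_ (sum_mem fun i hi => ?_)
  · obtain ⟨p, rfl⟩ := orderGE.exists_eq_smul_single hg
    rw [smul_assoc, single_zero_one, one_smul]
    exact M.smul_mem p (hM l)
  · rw [smul_assoc]
    exact Submodule.smul_mem _ _
      (Submodule.subset_span ⟨(i, l), ⟨by simpa using hi, Set.mem_univ l⟩, rfl⟩)

/-- For a connection `∇` on a finite-dimensional `ℂ((t))`-vector space `V` and a lattice
`L ⊂ V`, the preimage `∇⁻¹(L)` is again a lattice. -/
theorem preimage_of_lattice_is_lattice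
    (V : Type) [AddCommGroup V] [Module ℂ V] [Module (PowerSeries ℂ) V]
    [Module (LaurentSeries ℂ) V]
    [IsScalarTower ℂ (PowerSeries ℂ) V] [IsScalarTower ℂ (LaurentSeries ℂ) V]
    [IsScalarTower (PowerSeries ℂ) (LaurentSeries ℂ) V]
    [FiniteDimensional (LaurentSeries ℂ) V]
    (nabla : V →ₗ[ℂ] V)
    (hleib : ∀ (f : LaurentSeries ℂ) (v : V), nabla (f • v) = dt f • v + f • nabla v)
    (L : Submodule ℂ V) (hL : IsLatticeIn L) :
    IsLatticeIn (L.comap nabla) := by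
  obtain ⟨M, ⟨hfg, hspan⟩, hLM⟩ := hL
  obtain ⟨hLM, hML⟩ := areCommensurable_iff.1 hLM
  let b := Module.Basis.ofSpan hspan.ge
  have hbM : ∀ l, b l ∈ M := fun l => Module.Basis.ofSpan_subset hspan.ge ⟨l, rfl⟩
  have := FiniteDimensional.fintypeBasisIndex b
  obtain ⟨K, hK⟩ := exists_repr_mem_orderGE b
    (exists_functional_mem_orderGE nabla hleib ((M.restrictScalars ℂ).comap nabla)
      fun ψ => (exists_functional_mem_orderGE_of_fg hfg ψ).imp fun _ hN x hx => hN _ hx)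
  obtain ⟨M', hM', hKM'⟩ := exists_isOLattice_of_repr b K
  obtain ⟨K', hK'⟩ := exists_repr_mem_orderGE b (exists_functional_mem_orderGE_of_fg hM'.1)
  obtain ⟨J, hJ⟩ := exists_repr_mem_orderGE b
    (X := (M'.restrictScalars ℂ).map nabla) fun ψ => by
      obtain ⟨N, hN⟩ := exists_functional_nabla_mem_orderGE nabla hleib b hK' ψ
      refine ⟨N, ?_⟩
      rintro _ ⟨x, hx, rfl⟩
      exact hN x hx
  refine ⟨M', hM', areCommensurable_iff.2 ⟨?_, ?_⟩⟩
  · exact (hLM.comap nabla).trans (.of_le fun x hx => hKM' x (hK x hx))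
  · exact (AlmostLE.of_le (Submodule.le_comap_map nabla _)).trans
      (((almostLE_of_repr b hJ hbM).trans hML).comap nabla)
end
end
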